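/- arXiv:2005.05833 — 4 statements merged into one kernel-verified Lean document; each statement's English description precedes it below -/
import Mathlib

section
/- Let k be a field of characteristic zero. Let (R, m, k) be a finite-dimensional local k-algebra such that the composite k → R → R/m is an isomorphism. Then there exists a finite-dimensional local k-algebra (R', m', k) with k → R' → R'/m' an isomorphism, together with an injective local k-algebra homomorphism ι : R → R', such that the induced map Ω_{R/k} → Ω_{R'/k} is the zero map. -/
open TensorProduct in
/-- finite-dimensional, local with residue field `k`, phrased elementarily -/
def GoodAlg (k A : Type) [Field k] [CommRing A] [Algebra k A] : Prop :=
  FiniteDimensional k A ∧ Nontrivial A ∧ ∀ a : A, ∃ c : k, IsNilpotent (a - algebraMap k A c)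

theorem GoodAlg.isLocalRing {k A : Type} [Field k] [CommRing A] [Algebra k A]
    (h : GoodAlg k A) : IsLocalRing A := by
  obtain ⟨_, _, h⟩ := h
  refine IsLocalRing.of_isUnit_or_isUnit_one_sub_self fun a => ?_
  obtain ⟨c, hc⟩ := h a
  by_cases h0 : c = 0
  · right
    subst h0
    simp only [map_zero, sub_zero] at hc
    exact hc.isUnit_one_sub
  · left
    have hu : IsUnit (algebraMap k A c) := (IsUnit.mk0 c h0).map _
    have := hc.isUnit_add_left_of_commute hu (Commute.all _ _)
    simpa using this

theorem GoodAlg.bijective {k A : Type} [Field k] [CommRing A] [Algebra k A] [IsLocalRing A]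
    (h : GoodAlg k A) : Function.Bijective (algebraMap k (IsLocalRing.ResidueField A)) := by
  refine ⟨(algebraMap k (IsLocalRing.ResidueField A)).injective, fun y => ?_⟩
  obtain ⟨a, rfl⟩ := IsLocalRing.residue_surjective y
  obtain ⟨c, hc⟩ := h.2.2 a
  refine ⟨c, ?_⟩
  have h1 := hc.map (IsLocalRing.residue A)
  rw [isNilpotent_iff_eq_zero, map_sub, sub_eq_zero] at h1
  rw [h1]
  rfl

theorem GoodAlg.of_residue {k A : Type} [Field k] [CommRing A] [Algebra k A] [IsLocalRing A]
    [FiniteDimensional k A]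
    (h : Function.Bijective (algebraMap k (IsLocalRing.ResidueField A))) : GoodAlg k A := by
  refine ⟨inferInstance, inferInstance, fun a => ?_⟩
  obtain ⟨c, hc⟩ := h.2 (IsLocalRing.residue A a)
  refine ⟨c, ?_⟩
  have : IsArtinianRing A := IsArtinianRing.of_finite k A
  have hm : a - algebraMap k A c ∈ IsLocalRing.maximalIdeal A := by
    rw [← IsLocalRing.residue_eq_zero_iff, map_sub, ← hc, sub_eq_zero]
    rfl
  obtain ⟨n, hn⟩ := IsArtinianRing.isNilpotent_jacobson_bot (R := A)
  rw [IsLocalRing.jacobson_eq_maximalIdeal ⊥ bot_ne_top] at hn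
  refine ⟨n, ?_⟩
  have := Ideal.pow_mem_pow hm n
  rw [hn] at this
  simpa using this

theorem GoodAlg.quotient {k A : Type} [Field k] [CommRing A] [Algebra k A]
    (h : GoodAlg k A) (I : Ideal A) (hI : I ≠ ⊤) : GoodAlg k (A ⧸ I) := by
  have := h.1
  refine ⟨inferInstance, Ideal.Quotient.nontrivial_iff.mpr hI, fun a => ?_⟩
  obtain ⟨a, rfl⟩ := Ideal.Quotient.mk_surjective a
  obtain ⟨c, hc⟩ := h.2.2 a
  exact ⟨c, by simpa using hc.map (Ideal.Quotient.mk I)⟩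

open TensorProduct in
theorem GoodAlg.tensor {k A B : Type} [Field k] [CommRing A] [Algebra k A]
    [CommRing B] [Algebra k B]
    (hA : GoodAlg k A) (hB : GoodAlg k B) : GoodAlg k (A ⊗[k] B) := by
  obtain ⟨_, _, hA⟩ := hA
  obtain ⟨_, _, hB⟩ := hB
  refine ⟨inferInstance, inferInstance, fun t => ?_⟩
  induction t with
  | zero => exact ⟨0, by simp⟩
  | add x y hx hy =>
    obtain ⟨c, hc⟩ := hx
    obtain ⟨d, hd⟩ := hy
    refine ⟨c + d, ?_⟩
    have := (Commute.all _ _).isNilpotent_add hc hd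
    convert this using 1
    rw [map_add]; ring
  | tmul a b =>
    obtain ⟨c, hc⟩ := hA a
    obtain ⟨d, hd⟩ := hB b
    refine ⟨c * d, ?_⟩
    have h1 := hc.map (Algebra.TensorProduct.includeLeft : A →ₐ[k] A ⊗[k] B)
    have h2 := hd.map (Algebra.TensorProduct.includeRight : B →ₐ[k] A ⊗[k] B)
    have h3 := (Commute.all _ ((1 : A) ⊗ₜ[k] b)).isNilpotent_mul_right h1
    have h4 := (Commute.all _ (algebraMap k (A ⊗[k] B) c)).isNilpotent_mul_right h2
    have := (Commute.all _ _).isNilpotent_add h3 h4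
    convert this using 1
    simp only [map_sub, AlgHom.commutes, sub_mul, map_mul]
    have : a ⊗ₜ[k] b = (a ⊗ₜ[k] (1 : B)) * ((1 : A) ⊗ₜ[k] b) := by simp
    rw [this]
    simp only [Algebra.TensorProduct.includeLeft_apply, Algebra.TensorProduct.includeRight_apply]
    ring

theorem D_map_zero {k A B : Type} [Field k] [CommRing A] [Algebra k A] [CommRing B] [Algebra k B]
    (g : A →ₐ[k] B) (a : A) (h : KaehlerDifferential.D k A a = 0) :
    KaehlerDifferential.D k B (g a) = 0 := by
  let _ := g.toRingHom.toAlgebra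
  have : IsScalarTower k A B := IsScalarTower.of_algebraMap_eq fun c => (g.commutes c).symm
  have := KaehlerDifferential.map_D k k A B a
  rw [h, map_zero] at this
  exact this.symm

/-- the functional -/
noncomputable def phi (k : Type) [Field k] : MvPolynomial (Fin 2) k →ₗ[k] k :=
  MvPolynomial.lcoeff k (Finsupp.single 0 2 + Finsupp.single 1 2)
  + MvPolynomial.lcoeff k (Finsupp.single 0 5) + MvPolynomial.lcoeff k (Finsupp.single 1 5)

open MvPolynomial in
theorem phi_monomial (k : Type) [Field k] (a b : ℕ) :
    phi k (X 0 ^ a * X 1 ^ b) = if (a = 2 ∧ b = 2) ∨ (a = 5 ∧ b = 0) ∨ (a = 0 ∧ b = 5)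
      then 1 else 0 := by
  have h : (X 0 ^ a * X 1 ^ b : MvPolynomial (Fin 2) k) =
      monomial (Finsupp.single 0 a + Finsupp.single 1 b) 1 := by
    rw [X_pow_eq_monomial, X_pow_eq_monomial, monomial_mul, one_mul]
  rw [h]
  simp only [phi, LinearMap.add_apply, lcoeff_apply, coeff_monomial, Finsupp.ext_iff,
    Fin.forall_fin_two, Finsupp.add_apply, Finsupp.single_apply]
  simp
  split_ifs <;> first | omega | simp

open MvPolynomial in
theorem mv_ind {k : Type} [Field k] (F : MvPolynomial (Fin 2) k →ₗ[k] k)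
    (h : ∀ a b : ℕ, F (X 0 ^ a * X 1 ^ b) = 0) (q) : F q = 0 := by
  induction q using MvPolynomial.induction_on' with
  | monomial u c =>
    have : monomial u c = c • (X 0 ^ (u 0) * X 1 ^ (u 1) : MvPolynomial (Fin 2) k) := by
      rw [monomial_eq, Finsupp.prod_fintype _ _ (by simp), Fin.prod_univ_two, smul_eq_C_mul]
    rw [this, map_smul, h, smul_zero]
  | add p q hp hq => rw [map_add, hp, hq, add_zero]

open MvPolynomial in
noncomputable def J2 (k : Type) [Field k] : Ideal (MvPolynomial (Fin 2) k) :=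
  Ideal.span {X 0 ^ 4 - X 0 * X 1 ^ 2, X 1 ^ 4 - X 0 ^ 2 * X 1, X 0 ^ 6, X 1 ^ 6}

open MvPolynomial in
theorem phi_J2 (k : Type) [Field k] (p : MvPolynomial (Fin 2) k) (hp : p ∈ J2 k) :
    phi k p = 0 := by
  have key : ∀ q, phi k (q * p) = 0 := by
    unfold J2 at hp
    induction hp using Submodule.span_induction with
    | zero => simp
    | add x y _ _ hx hy => intro q; rw [mul_add, map_add, hx, hy, add_zero]
    | smul a x _ hx => intro q; rw [smul_eq_mul, ← mul_assoc]; exact hx _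
    | mem x hx =>
      refine mv_ind ((phi k).comp (LinearMap.mulRight k x)) fun a b => ?_
      simp only [LinearMap.comp_apply, LinearMap.mulRight_apply]
      simp only [Set.mem_insert_iff, Set.mem_singleton_iff] at hx
      rcases hx with rfl | rfl | rfl | rfl
      · rw [show (X 0 ^ a * X 1 ^ b * (X 0 ^ 4 - X 0 * X 1 ^ 2) : MvPolynomial (Fin 2) k) =
          X 0 ^ (a+4) * X 1 ^ b - X 0 ^ (a+1) * X 1 ^ (b+2) by ring, map_sub, phi_monomial,
          phi_monomial, sub_eq_zero]
        exact if_congr (by omega) rfl rfl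
      · rw [show (X 0 ^ a * X 1 ^ b * (X 1 ^ 4 - X 0 ^ 2 * X 1) : MvPolynomial (Fin 2) k) =
          X 0 ^ a * X 1 ^ (b+4) - X 0 ^ (a+2) * X 1 ^ (b+1) by ring, map_sub, phi_monomial,
          phi_monomial, sub_eq_zero]
        exact if_congr (by omega) rfl rfl
      · rw [show (X 0 ^ a * X 1 ^ b * (X 0 ^ 6) : MvPolynomial (Fin 2) k) =
          X 0 ^ (a+6) * X 1 ^ b by ring, phi_monomial]
        exact if_neg (by omega)
      · rw [show (X 0 ^ a * X 1 ^ b * (X 1 ^ 6) : MvPolynomial (Fin 2) k) =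
          X 0 ^ a * X 1 ^ (b+6) by ring, phi_monomial]
        exact if_neg (by omega)
  simpa using key 1

open MvPolynomial in
theorem exists_A2 (k : Type) [Field k] [CharZero k] :
    ∃ (A : Type) (_ : CommRing A) (_ : Algebra k A) (f : A), GoodAlg k A ∧
      KaehlerDifferential.D k A f = 0 ∧ f ^ 2 = 0 ∧ f ≠ 0 := by
  let π := Ideal.Quotient.mkₐ k (J2 k)
  have hπ : Function.Surjective π := Ideal.Quotient.mkₐ_surjective k (J2 k)
  have hrel : ∀ p ∈ J2 k, π p = 0 := fun p hp => Ideal.Quotient.eq_zero_iff_mem.mpr hp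
  let y := π (X 0)
  let z := π (X 1)
  have r1 : y ^ 4 = y * z ^ 2 := by
    have := hrel (X 0 ^ 4 - X 0 * X 1 ^ 2) (Ideal.subset_span (by simp))
    simpa [sub_eq_zero] using this
  have r2 : z ^ 4 = y ^ 2 * z := by
    have := hrel (X 1 ^ 4 - X 0 ^ 2 * X 1) (Ideal.subset_span (by simp))
    simpa [sub_eq_zero] using this
  have r3 : y ^ 6 = 0 := by
    have := hrel (X 0 ^ 6) (Ideal.subset_span (by simp))
    simpa using this
  have r4 : z ^ 6 = 0 := by
    have := hrel (X 1 ^ 6) (Ideal.subset_span (by simp))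
    simpa using this
  have hne : y ^ 2 * z ^ 2 ≠ 0 := by
    intro h
    have h' : π (X 0 ^ 2 * X 1 ^ 2) = 0 := by simpa using h
    have := phi_J2 k _ (Ideal.Quotient.eq_zero_iff_mem.mp h')
    rw [phi_monomial] at this
    simp at this
  have hnil : ∀ a : MvPolynomial (Fin 2) k ⧸ J2 k, ∃ c : k,
      IsNilpotent (a - algebraMap k _ c) := by
    intro a
    obtain ⟨p, rfl⟩ := hπ a
    induction p using MvPolynomial.induction_on with
    | C c => exact ⟨c, 1, by rw [pow_one, sub_eq_zero]; rfl⟩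
    | add p q hp hq =>
      obtain ⟨c, hc⟩ := hp
      obtain ⟨d, hd⟩ := hq
      refine ⟨c + d, ?_⟩
      have h2 := (Commute.all _ _).isNilpotent_add hc hd
      rw [map_add, map_add, add_sub_add_comm]
      exact h2
    | mul_X p i hp =>
      refine ⟨0, ?_⟩
      rw [map_zero, sub_zero, map_mul]
      refine (Commute.all _ _).isNilpotent_mul_left ⟨6, ?_⟩
      fin_cases i
      · exact r3
      · exact r4
  refine ⟨MvPolynomial (Fin 2) k ⧸ J2 k, inferInstance, inferInstance, y ^ 2 * z ^ 2, ⟨?_, ?_, ?_⟩,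
    ?_, ?_, hne⟩
  · have h_integral : Algebra.IsIntegral k (MvPolynomial (Fin 2) k ⧸ J2 k) := by
      refine ⟨fun a => ?_⟩
      obtain ⟨c, n, hn⟩ := hnil a
      have h1 : IsIntegral k (a - algebraMap k _ c) := by
        refine IsIntegral.of_pow (Nat.succ_pos n) ?_
        rw [pow_succ, hn, zero_mul]
        exact isIntegral_zero
      simpa using h1.add (isIntegral_algebraMap (x := c))
    have : Algebra.FiniteType k (MvPolynomial (Fin 2) k ⧸ J2 k) := inferInstance
    exact Algebra.IsIntegral.finite
  · exact ⟨_, _, hne⟩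
  · exact hnil
  · have e1 : y ^ 5 = y ^ 2 * z ^ 2 := by linear_combination y * r1
    have e2 : z ^ 5 = y ^ 2 * z ^ 2 := by linear_combination z * r2
    set D := KaehlerDifferential.D k (MvPolynomial (Fin 2) k ⧸ J2 k)
    have d1 : D (y ^ 2 * z ^ 2) = (5 : k) • (y ^ 4 • D y) := by
      rw [← e1, D.leibniz_pow]
      norm_num [← Nat.cast_smul_eq_nsmul k]
    have d2 : D (y ^ 2 * z ^ 2) = (5 : k) • (z ^ 4 • D z) := by
      rw [← e2, D.leibniz_pow]
      norm_num [← Nat.cast_smul_eq_nsmul k]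
    have d3 : D (y ^ 2 * z ^ 2) = (2 : k) • (y ^ 4 • D y) + (2 : k) • (z ^ 4 • D z) := by
      rw [D.leibniz, D.leibniz_pow, D.leibniz_pow, r1, r2]
      simp only [← Nat.cast_smul_eq_nsmul k, smul_comm _ (_ : k), smul_smul]
      norm_num
      rw [add_comm, mul_comm (z ^ 2) y]
    have d4 : (5 : k) • D (y ^ 2 * z ^ 2) = (4 : k) • D (y ^ 2 * z ^ 2) := by
      conv_lhs => rw [d3]
      rw [smul_add, smul_comm (5 : k) (2 : k), smul_comm (5 : k) (2 : k), ← d1, ← d2, ← add_smul]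
      norm_num
    have d5 : ((5 : k) - 4) • D (y ^ 2 * z ^ 2) = 0 := by rw [sub_smul, d4, sub_self]
    rwa [show (5 : k) - 4 = 1 by norm_num, one_smul] at d5
  · linear_combination y ^ 0 * z ^ 4 * r1 + y * r4

open TensorProduct in
theorem exists_An (k : Type) [Field k] [CharZero k] (n : ℕ) :
    ∃ (A : Type) (_ : CommRing A) (_ : Algebra k A) (f : A), GoodAlg k A ∧
      KaehlerDifferential.D k A f = 0 ∧ f ^ (n + 1) = 0 ∧ f ^ n ≠ 0 := by
  induction n with
  | zero =>
    refine ⟨k, inferInstance, inferInstance, 0, ⟨inferInstance, inferInstance, fun a => ⟨a, ?_⟩⟩,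
      by simp, by simp, by simp⟩
    simp
  | succ n ih =>
    obtain ⟨A, _, _, f, hA, hD, h0, h1⟩ := ih
    obtain ⟨B, _, _, g, hB, hDg, hg0, hg1⟩ := exists_A2 k
    have key : ∀ m : ℕ, (f ⊗ₜ[k] (1 : B) + (1 : A) ⊗ₜ[k] g) ^ (m + 1) =
        (f ^ (m + 1)) ⊗ₜ[k] (1 : B) + ((m : k) + 1) • ((f ^ m) ⊗ₜ[k] g) := by
      intro m
      induction m with
      | zero => simp
      | succ m ihm =>
        rw [pow_succ, ihm]
        have hgg : g * g = 0 := by rw [← sq, hg0]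
        simp only [add_mul, mul_add, smul_mul_assoc, Algebra.TensorProduct.tmul_mul_tmul, hgg,
          TensorProduct.tmul_zero, smul_zero, mul_one, one_mul, ← pow_succ, add_zero]
        push_cast
        module
    refine ⟨A ⊗[k] B, inferInstance, inferInstance, f ⊗ₜ 1 + 1 ⊗ₜ g, hA.tensor hB, ?_, ?_, ?_⟩
    · rw [map_add]
      have a1 := D_map_zero (Algebra.TensorProduct.includeLeft : A →ₐ[k] A ⊗[k] B) f hD
      have a2 := D_map_zero (Algebra.TensorProduct.includeRight : B →ₐ[k] A ⊗[k] B) g hDg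
      simp only [Algebra.TensorProduct.includeLeft_apply,
        Algebra.TensorProduct.includeRight_apply] at a1 a2
      rw [a1, a2, add_zero]
    · rw [key, pow_succ, h0]; simp
    · rw [key, h0, TensorProduct.zero_tmul, zero_add]
      refine smul_ne_zero (by exact_mod_cast n.succ_ne_zero) ?_
      intro h
      have hex : ∀ {V : Type} [AddCommGroup V] [Module k V] (v : V), v ≠ 0 →
          ∃ φ : V →ₗ[k] k, φ v ≠ 0 := by
        intro V _ _ v hv
        by_contra! hc
        exact hv ((Module.forall_dual_apply_eq_zero_iff k v).mp hc)
      obtain ⟨φ, hφ⟩ := hex _ h1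
      obtain ⟨ψ, hψ⟩ := hex _ hg1
      have h2 := congrArg (TensorProduct.map φ ψ) h
      have h3 := congrArg (TensorProduct.lid k k) h2
      simp only [TensorProduct.map_tmul, TensorProduct.lid_tmul, map_zero, smul_eq_mul] at h3
      exact mul_ne_zero hφ hψ h3

theorem exists_functional {k A : Type} [Field k] [CommRing A] [Algebra k A] (n : ℕ) (f : A)
    (h0 : f ^ (n + 1) = 0) (h1 : f ^ n ≠ 0) :
    ∃ φ : A →ₗ[k] k, ∀ i ≤ n, φ (f ^ i) = if i = n then 1 else 0 := by
  have hli : LinearIndependent k (fun i : Fin (n + 1) => f ^ (i : ℕ)) := by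
    rw [Fintype.linearIndependent_iff]
    intro c hc
    by_contra! hne
    obtain ⟨i, hi⟩ := hne
    have hex : ∃ m : ℕ, ∃ hm : m < n + 1, c ⟨m, hm⟩ ≠ 0 := ⟨i, i.2, hi⟩
    classical
    obtain ⟨hm, hcm⟩ := Nat.find_spec hex
    set m := Nat.find hex
    have hlt : ∀ j : Fin (n + 1), (j : ℕ) < m → c j = 0 := by
      intro j hj
      by_contra h
      exact Nat.find_min hex hj ⟨j.2, h⟩
    have h2 : f ^ (n - m) * ∑ i, c i • f ^ (i : ℕ) = 0 := by rw [hc, mul_zero]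
    rw [Finset.mul_sum, Finset.sum_eq_single ⟨m, hm⟩] at h2
    · rw [mul_smul_comm, ← pow_add, Nat.sub_add_cancel (by omega)] at h2
      exact (smul_ne_zero hcm h1) h2
    · intro j _ hj
      rw [mul_smul_comm, ← pow_add]
      rcases lt_trichotomy (j : ℕ) m with h | h | h
      · rw [hlt j h, zero_smul]
      · exact absurd (Fin.ext h) hj
      · rw [pow_eq_zero_of_le (by omega : n + 1 ≤ n - m + j) h0, smul_zero]
    · simp
  obtain ⟨φ, hφ⟩ := LinearMap.exists_extend ((Module.Basis.span hli).constr k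
    (fun i : Fin (n + 1) => if (i : ℕ) = n then (1 : k) else 0))
  refine ⟨φ, fun i hi => ?_⟩
  have h := LinearMap.congr_fun hφ (Module.Basis.span hli ⟨i, by omega⟩)
  rw [Module.Basis.constr_basis, LinearMap.comp_apply, Submodule.subtype_apply,
    Module.Basis.span_apply] at h
  exact h

open TensorProduct in
theorem step {k R : Type} [Field k] [CharZero k] [CommRing R] [Algebra k R] (hR : GoodAlg k R)
    (x : R) (hx : IsNilpotent x) :
    ∃ (R' : Type) (_ : CommRing R') (_ : Algebra k R') (j : R →ₐ[k] R'), GoodAlg k R' ∧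
      Function.Injective j ∧ KaehlerDifferential.D k R' (j x) = 0 := by
  obtain ⟨n, hn⟩ := hx
  replace hn : x ^ (n + 1) = 0 := by rw [pow_succ, hn, zero_mul]
  obtain ⟨A, _, _, f, hA, hD, h0, h1⟩ := exists_An k n
  obtain ⟨φ, hφ⟩ := exists_functional (k := k) n f h0 h1
  let Φ : A →ₗ[k] R := ∑ i ∈ Finset.range (n + 1),
    (LinearMap.toSpanSingleton k R (x ^ i)).comp (φ.comp (LinearMap.mulLeft k (f ^ (n - i))))
  have Φa : ∀ a, Φ a = ∑ i ∈ Finset.range (n + 1), φ (f ^ (n - i) * a) • x ^ i := by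
    intro a; simp [Φ]
  have Φ1 : Φ 1 = 1 := by
    rw [Φa, Finset.sum_eq_single 0]
    · simp [hφ n le_rfl]
    · intro i hi hi0
      rw [Finset.mem_range] at hi
      rw [mul_one, hφ _ (by omega), if_neg (by omega), zero_smul]
    · simp
  have Φf : ∀ a, Φ (f * a) = x * Φ a := by
    intro a
    rw [Φa, Φa, Finset.sum_range_succ', Finset.sum_range_succ, mul_add, Finset.mul_sum]
    congr 1
    · refine Finset.sum_congr rfl fun i hi => ?_
      rw [Finset.mem_range] at hi
      rw [mul_smul_comm, ← pow_succ', ← mul_assoc, ← pow_succ,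
        show n - (i + 1) + 1 = n - i by omega]
    · rw [mul_smul_comm, ← pow_succ', hn, ← mul_assoc, ← pow_succ, Nat.sub_zero, h0]
      simp
  let Ψ : R ⊗[k] A →ₗ[k] R := TensorProduct.lift ((LinearMap.mul k R).compl₂ Φ)
  have Ψt : ∀ r a, Ψ (r ⊗ₜ a) = r * Φ a := by intro r a; simp [Ψ]
  let t : R ⊗[k] A := x ⊗ₜ 1 - 1 ⊗ₜ f
  have Ψ0 : ∀ s, Ψ (s * t) = 0 := by
    intro s
    induction s with
    | zero => simp
    | add a b ha hb => rw [add_mul, map_add, ha, hb, add_zero]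
    | tmul r a =>
      simp only [t, mul_sub, Algebra.TensorProduct.tmul_mul_tmul, map_sub, Ψt, mul_one]
      rw [mul_comm a f, Φf]; ring
  have hinj : ∀ r : R, r ⊗ₜ[k] (1 : A) ∈ Ideal.span {t} → r = 0 := by
    intro r hr
    obtain ⟨s, hs⟩ := Ideal.mem_span_singleton'.mp hr
    have := Ψ0 s
    rw [hs, Ψt, Φ1, mul_one] at this
    exact this
  have hnt := hR.2.1
  let q := Ideal.Quotient.mkₐ k (Ideal.span {t})
  let j : R →ₐ[k] (R ⊗[k] A) ⧸ Ideal.span {t} :=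
    q.comp (Algebra.TensorProduct.includeLeft : R →ₐ[k] R ⊗[k] A)
  refine ⟨(R ⊗[k] A) ⧸ Ideal.span {t}, inferInstance, inferInstance, j, ?_, ?_, ?_⟩
  · refine (hR.tensor hA).quotient _ fun h => one_ne_zero (hinj 1 ?_)
    rw [h]; trivial
  · rw [injective_iff_map_eq_zero]
    intro r hr
    exact hinj r (Ideal.Quotient.eq_zero_iff_mem.mp hr)
  · have hj : j x = (q.comp (Algebra.TensorProduct.includeRight : A →ₐ[k] R ⊗[k] A)) f := by
      have : q t = 0 := Ideal.Quotient.eq_zero_iff_mem.mpr (Ideal.mem_span_singleton_self t)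
      rw [map_sub, sub_eq_zero] at this
      exact this
    rw [hj]
    exact D_map_zero _ f hD

theorem step_finset {k R : Type} [Field k] [CharZero k] [CommRing R] [Algebra k R]
    (hR : GoodAlg k R) (s : Finset R) :
    ∃ (R' : Type) (_ : CommRing R') (_ : Algebra k R') (j : R →ₐ[k] R'), GoodAlg k R' ∧
      Function.Injective j ∧ ∀ x ∈ s, KaehlerDifferential.D k R' (j x) = 0 := by
  classical
  induction s using Finset.induction_on with
  | empty => exact ⟨R, inferInstance, inferInstance, AlgHom.id k R, hR, fun _ _ h => h, by simp⟩
  | insert x s _ ih =>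
    obtain ⟨S, _, _, j, hS, hj, hD⟩ := ih
    obtain ⟨c, hc⟩ := hS.2.2 (j x)
    obtain ⟨T, _, _, i, hT, hi, hDx⟩ := step hS _ hc
    refine ⟨T, inferInstance, inferInstance, i.comp j, hT, hi.comp hj, fun y hy => ?_⟩
    rcases Finset.mem_insert.mp hy with rfl | hy
    · rw [map_sub, AlgHom.commutes, map_sub, Derivation.map_algebraMap, sub_zero] at hDx
      exact hDx
    · exact D_map_zero i _ (hD y hy)

/-- Lemma 2.5: given a finite dimensional local `k`-algebra `R` (`char k = 0`)
with residue field `k`, there is a finite dimensional local `k`-algebra `R'`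
with residue field `k` and an injective local `k`-algebra map `R → R'`
killing all Kähler differentials. -/
theorem stmt6 (k : Type) [Field k] [CharZero k]
    (R : Type) [CommRing R] [IsLocalRing R] [Algebra k R] [FiniteDimensional k R]
    (hres : Function.Bijective (algebraMap k (IsLocalRing.ResidueField R))) :
    ∃ (R' : Type) (_ : CommRing R') (_ : IsLocalRing R') (_ : Algebra k R')
      (_ : FiniteDimensional k R')
      (_ : Function.Bijective (algebraMap k (IsLocalRing.ResidueField R')))
      (_ : Algebra R R') (_ : IsScalarTower k R R'),
      Function.Injective (algebraMap R R') ∧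
      (KaehlerDifferential.map k k R R' :
        KaehlerDifferential k R →ₗ[R] KaehlerDifferential k R') = 0 := by
  obtain ⟨s, hs⟩ := (Module.finite_def (R := k) (M := R)).mp inferInstance
  obtain ⟨R', _, _, j, hR', hj, hD⟩ := step_finset (GoodAlg.of_residue hres) s
  let _ := j.toRingHom.toAlgebra
  have : IsScalarTower k R R' := IsScalarTower.of_algebraMap_eq fun c => (j.commutes c).symm
  have := hR'.isLocalRing
  refine ⟨R', inferInstance, inferInstance, inferInstance, hR'.1, hR'.bijective, inferInstance,
    inferInstance, hj, ?_⟩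
  have hall : ∀ r : R, KaehlerDifferential.D k R' (j r) = 0 := by
    intro r
    have hr : r ∈ Submodule.span k (s : Set R) := by rw [hs]; trivial
    induction hr using Submodule.span_induction with
    | mem x hx => exact hD x hx
    | zero => simp
    | add x y _ _ hx hy => rw [map_add, map_add, hx, hy, add_zero]
    | smul c x _ hx => rw [map_smul, Derivation.map_smul, hx, smul_zero]
  apply LinearMap.ext_on (KaehlerDifferential.span_range_derivation k R)
  rintro _ ⟨r, rfl⟩
  rw [KaehlerDifferential.map_D, LinearMap.zero_apply]
  exact hall r
end

section
/- For any field k of characteristic zero, there exists a local k-algebra R with nonzero maximal ideal consisting of nilpotent elements such that Ω_{R/k} = 0. In particular, there is a formally unramified k-algebra that is not reduced. -/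
namespace Gab

/-- Split off one square-zero summand from a nilpotent element. -/
lemma step1 (k : Type) [Field k] [CharZero k] (R : Type) [CommRing R] [Algebra k R]
    (x : R) (n : ℕ) (hx : x ^ (n + 2) = 0) :
    ∃ (R' : Type) (_ : CommRing R') (_ : Algebra k R') (φ : R →ₐ[k] R'),
      Function.Injective φ ∧ ∃ s : R', s ^ 2 = 0 ∧ (φ x - s) ^ (n + 1) = 0 := by
  let g : DualNumber R := (TrivSqZeroExt.inl x - DualNumber.eps) ^ (n + 1)
  let I : Ideal (DualNumber R) := Ideal.span {g}
  let ψ : R →ₐ[k] DualNumber R := TrivSqZeroExt.inlAlgHom k R R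
  refine ⟨DualNumber R ⧸ I, inferInstance, inferInstance,
    (Ideal.Quotient.mkₐ k I).comp ψ, ?_, Ideal.Quotient.mk I DualNumber.eps, ?_, ?_⟩
  · rw [injective_iff_map_eq_zero]
    intro r hr
    have h1 : ψ r ∈ I := by
      rw [← Ideal.Quotient.eq_zero_iff_mem]; exact hr
    rw [Ideal.mem_span_singleton'] at h1
    obtain ⟨c, hc⟩ := h1
    have hf := congrArg TrivSqZeroExt.fst hc
    have hs := congrArg TrivSqZeroExt.snd hc
    simp only [g, ψ, TrivSqZeroExt.fst_mul, TrivSqZeroExt.fst_pow, TrivSqZeroExt.snd_mul,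
      TrivSqZeroExt.snd_pow, TrivSqZeroExt.fst_sub, TrivSqZeroExt.snd_sub,
      TrivSqZeroExt.fst_inl, TrivSqZeroExt.snd_inl, DualNumber.fst_eps, DualNumber.snd_eps,
      TrivSqZeroExt.inlAlgHom_apply, smul_eq_mul, sub_zero, nsmul_eq_mul,
      MulOpposite.smul_eq_mul_unop, MulOpposite.unop_op, Nat.pred_succ, zero_sub,
      ] at hf hs
    have h2 : ((n + 1 : ℕ) : R) * r = 0 := by
      rw [← hf]
      linear_combination (-x) * hs + c.snd * hx
    have h3 : IsUnit ((n + 1 : ℕ) : R) := by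
      have : IsUnit ((n + 1 : ℕ) : k) := by
        rw [isUnit_iff_ne_zero]; exact_mod_cast Nat.succ_ne_zero n
      simpa using this.map (algebraMap k R)
    exact (h3.mul_right_eq_zero).1 h2
  · rw [← map_pow, pow_two, DualNumber.eps_mul_eps, map_zero]
  · have : (((Ideal.Quotient.mkₐ k I).comp ψ) x - Ideal.Quotient.mk I DualNumber.eps) ^ (n + 1)
        = Ideal.Quotient.mk I g := by
      simp [g, ψ]
    rw [this, Ideal.Quotient.eq_zero_iff_mem]
    exact Ideal.subset_span rfl

lemma step2 (k : Type) [Field k] [CharZero k] (n : ℕ) : ∀ (R : Type) [CommRing R] [Algebra k R]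
    (x : R) (_ : x ^ (n + 1) = 0),
    ∃ (R' : Type) (_ : CommRing R') (_ : Algebra k R') (φ : R →ₐ[k] R'),
      Function.Injective φ ∧ ∃ s : ℕ → R', (∀ i, s i ^ 2 = 0) ∧
        φ x = ∑ i ∈ Finset.range n, s i := by
  induction n with
  | zero =>
    intro R _ _ x hx
    refine ⟨R, inferInstance, inferInstance, AlgHom.id k R, fun _ _ h => h, 0, ?_, ?_⟩
    · simp
    · simpa using hx
  | succ n ih =>
    intro R _ _ x hx
    obtain ⟨R₁, _, _, φ, hφ, s, hs, hy⟩ := step1 k R x n hx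
    obtain ⟨R₂, _, _, χ, hχ, t, ht, hsum⟩ := ih R₁ _ hy
    refine ⟨R₂, inferInstance, inferInstance, χ.comp φ, hχ.comp hφ,
      fun i => if i = n then χ s else t i, ?_, ?_⟩
    · intro i
      by_cases h : i = n
      · simp [h, ← map_pow, hs]
      · simp [h, ht]
    · rw [Finset.sum_range_succ]
      have : ∑ i ∈ Finset.range n, (if i = n then χ s else t i) = ∑ i ∈ Finset.range n, t i := by
        apply Finset.sum_congr rfl
        intro i hi
        rw [if_neg (Finset.mem_range.1 hi).ne]
      rw [this, ← hsum]
      simp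

/-- Values of the functional on monomials. -/
def gg (a b : ℕ) : ℤ :=
  if a = 2 ∧ b = 2 then 5 else if a = 5 ∧ b = 0 then -2 else if a = 0 ∧ b = 5 then -2 else 0

open MvPolynomial in
/-- The functional. -/
noncomputable def lam (R : Type) [CommRing R] : MvPolynomial (Fin 2) R →ₗ[R] R :=
  (basisMonomials (Fin 2) R).constr R (fun s => ((gg (s 0) (s 1) : ℤ) : R))

open MvPolynomial in
lemma lam_X (R : Type) [CommRing R] (a b : ℕ) :
    lam R (X 0 ^ a * X 1 ^ b) = ((gg a b : ℤ) : R) := by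
  have : (X 0 ^ a * X 1 ^ b : MvPolynomial (Fin 2) R) =
      basisMonomials (Fin 2) R (Finsupp.single 0 a + Finsupp.single 1 b) := by
    simp [X_pow_eq_monomial, monomial_mul]
  rw [this, lam, Module.Basis.constr_basis]
  simp

open MvPolynomial in
lemma ext2 (R : Type) [CommRing R] (f : MvPolynomial (Fin 2) R →ₗ[R] R)
    (h : ∀ a b, f (X 0 ^ a * X 1 ^ b) = 0) (q : MvPolynomial (Fin 2) R) : f q = 0 := by
  have : f = 0 := by
    apply (basisMonomials (Fin 2) R).ext
    intro s
    have h1 : (X 0 ^ (s 0) * X 1 ^ (s 1) : MvPolynomial (Fin 2) R) =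
        basisMonomials (Fin 2) R s := by
      rw [coe_basisMonomials]
      change _ = monomial s 1
      rw [monomial_eq]
      simp [Finsupp.prod_fintype]
    rw [← h1, h]; rfl
  rw [this]; rfl

open MvPolynomial in
lemma step3 (k : Type) [Field k] (R : Type) [CommRing R] [Algebra k R]
    (x : R) (hx : x ^ 2 = 0) :
    ∃ (R' : Type) (_ : CommRing R') (_ : Algebra k R') (φ : R →ₐ[k] R'),
      Function.Injective φ ∧ ∃ u v : R', u ^ 6 = 0 ∧ v ^ 6 = 0 ∧
        φ x = u ^ 5 + u ^ 2 * v ^ 2 + v ^ 5 ∧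
        5 * u ^ 4 + 2 * (u * v ^ 2) = 0 ∧ 5 * v ^ 4 + 2 * (u ^ 2 * v) = 0 := by
  let P := MvPolynomial (Fin 2) R
  let U : P := X 0
  let V : P := X 1
  let F : P := U ^ 5 + U ^ 2 * V ^ 2 + V ^ 5
  have key : ∀ (p : P), (∀ a b, lam R (p * (U ^ a * V ^ b)) = 0) → ∀ q, lam R (p * q) = 0 := by
    intro p hp q
    exact ext2 R ((lam R).comp (LinearMap.mulLeft R p)) hp q
  have kU : ∀ q, lam R (U ^ 6 * q) = 0 := by
    refine key _ fun a b => ?_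
    rw [show U ^ 6 * (U ^ a * V ^ b) = U ^ (a + 6) * V ^ b by ring, lam_X]
    simp [gg]
  have kV : ∀ q, lam R (V ^ 6 * q) = 0 := by
    refine key _ fun a b => ?_
    rw [show V ^ 6 * (U ^ a * V ^ b) = U ^ a * V ^ (b + 6) by ring, lam_X]
    simp [gg]
  have kFU : ∀ q, lam R ((5 * U ^ 4 + 2 * (U * V ^ 2)) * q) = 0 := by
    refine key _ fun a b => ?_
    rw [show (5 * U ^ 4 + 2 * (U * V ^ 2)) * (U ^ a * V ^ b) =
      (5 : ℤ) • (U ^ (a + 4) * V ^ b) + (2 : ℤ) • (U ^ (a + 1) * V ^ (b + 2)) by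
        simp only [zsmul_eq_mul]; push_cast; ring, map_add, map_zsmul, map_zsmul, lam_X, lam_X]
    have : 5 * gg (a + 4) b + 2 * gg (a + 1) (b + 2) = 0 := by
      unfold gg; grind
    simp only [zsmul_eq_mul]
    exact_mod_cast congrArg (Int.cast : ℤ → R) this
  have kFV : ∀ q, lam R ((5 * V ^ 4 + 2 * (U ^ 2 * V)) * q) = 0 := by
    refine key _ fun a b => ?_
    rw [show (5 * V ^ 4 + 2 * (U ^ 2 * V)) * (U ^ a * V ^ b) =
      (5 : ℤ) • (U ^ a * V ^ (b + 4)) + (2 : ℤ) • (U ^ (a + 2) * V ^ (b + 1)) by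
        simp only [zsmul_eq_mul]; push_cast; ring, map_add, map_zsmul, map_zsmul, lam_X, lam_X]
    have : 5 * gg a (b + 4) + 2 * gg (a + 2) (b + 1) = 0 := by
      unfold gg; grind
    simp only [zsmul_eq_mul]
    exact_mod_cast congrArg (Int.cast : ℤ → R) this
  have kFF : ∀ q, lam R (F * F * q) = 0 := by
    refine key _ fun a b => ?_
    rw [show F * F * (U ^ a * V ^ b) =
      U ^ (a + 10) * V ^ b + U ^ (a + 4) * V ^ (b + 4) + U ^ a * V ^ (b + 10)
       + (2 : ℤ) • (U ^ (a + 7) * V ^ (b + 2)) + (2 : ℤ) • (U ^ (a + 5) * V ^ (b + 5))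
       + (2 : ℤ) • (U ^ (a + 2) * V ^ (b + 7)) by
        simp only [zsmul_eq_mul, F]; push_cast; ring]
    rw [map_add, map_add, map_add, map_add, map_add, map_zsmul, map_zsmul, map_zsmul, lam_X,
      lam_X, lam_X, lam_X, lam_X, lam_X]
    simp [gg]
  have hF1 : lam R F = 1 := by
    rw [show F = U ^ 5 * V ^ 0 + U ^ 2 * V ^ 2 + U ^ 0 * V ^ 5 by simp [F], map_add, map_add,
      lam_X, lam_X, lam_X]
    simp [gg]; norm_num
  have h1 : lam R 1 = 0 := by
    rw [show (1 : P) = U ^ 0 * V ^ 0 by simp, lam_X]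
    simp [gg]
  have hC : ∀ (r : R) (q : P), lam R (C r * q) = r * lam R q := by
    intro r q
    rw [← smul_eq_C_mul, map_smul, smul_eq_mul]
  let I : Ideal P :=
    { carrier := {p | ∀ q, lam R (F * (p * q)) + x * lam R (p * q) = 0}
      add_mem' := by
        intro a b ha hb q
        have := ha q
        have := hb q
        simp only [add_mul, mul_add, map_add] at *
        linear_combination ha q + hb q
      zero_mem' := by intro q; simp
      smul_mem' := by
        intro c p hp q
        have := hp (c * q)
        rw [smul_eq_mul, show c * p * q = p * (c * q) by ring]
        exact this }
  have memI : ∀ p : P, (∀ q, lam R (p * q) = 0) → p ∈ I := by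
    intro p hp q
    rw [show F * (p * q) = p * (F * q) by ring, hp, hp]; simp
  refine ⟨P ⧸ I, inferInstance, inferInstance,
    (Ideal.Quotient.mkₐ k I).comp (IsScalarTower.toAlgHom k R P), ?_,
    Ideal.Quotient.mk I U, Ideal.Quotient.mk I V, ?_, ?_, ?_, ?_, ?_⟩
  · rw [injective_iff_map_eq_zero]
    intro r hr
    have h2 : (C r : P) ∈ I := by
      rw [← Ideal.Quotient.eq_zero_iff_mem]; exact hr
    have h3 := h2 1
    rw [show F * (C r * 1) = C r * F by ring, hC, hC, hF1, h1] at h3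
    simpa using h3
  · rw [← map_pow, Ideal.Quotient.eq_zero_iff_mem]; exact memI _ kU
  · rw [← map_pow, Ideal.Quotient.eq_zero_iff_mem]; exact memI _ kV
  · have : Ideal.Quotient.mk I (C x) = Ideal.Quotient.mk I F := by
      rw [Ideal.Quotient.eq]
      intro q
      rw [show F * ((C x - F) * q) = C x * (F * q) - F * F * q by ring,
        show (C x - F) * q = C x * q - F * q by ring, map_sub, map_sub, kFF, hC, hC]
      linear_combination lam R q * hx
    change Ideal.Quotient.mk I (C x) = _
    rw [this]
    simp only [F, map_add, map_mul, map_pow]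
  · have := (Ideal.Quotient.eq_zero_iff_mem (I := I)).2 (memI _ kFU)
    simpa only [map_add, map_mul, map_pow, map_ofNat] using this
  · have := (Ideal.Quotient.eq_zero_iff_mem (I := I)).2 (memI _ kFV)
    simpa only [map_add, map_mul, map_pow, map_ofNat] using this

/-- The defining relations between the square-zero generators. -/
def Rel {R : Type} [CommRing R] (x u v : R) : Prop :=
  x = u ^ 5 + u ^ 2 * v ^ 2 + v ^ 5 ∧
    5 * u ^ 4 + 2 * (u * v ^ 2) = 0 ∧ 5 * v ^ 4 + 2 * (u ^ 2 * v) = 0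

lemma Rel.map {R S : Type} [CommRing R] [CommRing S] (f : R →+* S) {x u v : R}
    (h : Rel x u v) : Rel (f x) (f u) (f v) := by
  obtain ⟨h1, h2, h3⟩ := h
  refine ⟨by simp [h1], ?_, ?_⟩
  · simpa only [map_add, map_mul, map_pow, map_ofNat, map_zero] using congrArg f h2
  · simpa only [map_add, map_mul, map_pow, map_ofNat, map_zero] using congrArg f h3

lemma step4 (k : Type) [Field k] [CharZero k] (R : Type) [CommRing R] [Algebra k R]
    (x : R) (hx : x ^ 2 = 0) :
    ∃ (R' : Type) (_ : CommRing R') (_ : Algebra k R') (φ : R →ₐ[k] R'),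
      Function.Injective φ ∧ ∃ s t : ℕ → R', (∀ i, s i ^ 2 = 0) ∧ (∀ i, t i ^ 2 = 0) ∧
        Rel (φ x) (∑ i ∈ Finset.range 5, s i) (∑ i ∈ Finset.range 5, t i) := by
  obtain ⟨R₁, _, _, φ, hφ, u, v, hu, hv, hr⟩ := step3 k R x hx
  have hr : Rel (φ x) u v := hr
  obtain ⟨R₂, _, _, χ, hχ, s, hs, hsu⟩ := step2 k 5 R₁ u hu
  have hv' : (χ v) ^ 6 = 0 := by rw [← map_pow, hv, map_zero]
  obtain ⟨R₃, _, _, ω, hω, t, ht, htv⟩ := step2 k 5 R₂ (χ v) hv'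
  refine ⟨R₃, inferInstance, inferInstance, ω.comp (χ.comp φ), hω.comp (hχ.comp hφ),
    fun i => ω (s i), t, ?_, ht, ?_⟩
  · intro i; rw [← map_pow, hs, map_zero]
  · have := (hr.map (χ : R₁ →+* R₂)).map (ω : R₂ →+* R₃)
    simp only [RingHom.coe_coe] at this
    rw [hsu, htv, map_sum] at this
    exact this

lemma chain (k : Type) [Field k] [CharZero k] (j : ℕ) :
    ∃ (R : Type) (_ : CommRing R) (_ : Algebra k R) (e : ℕ → R),
      (∀ i, e i ^ 2 = 0) ∧ e 0 ≠ 0 ∧ ∀ i < j,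
        Rel (e i) (∑ l ∈ Finset.range 5, e (10 * i + 1 + l))
          (∑ l ∈ Finset.range 5, e (10 * i + 6 + l)) := by
  induction j with
  | zero =>
    refine ⟨DualNumber k, inferInstance, inferInstance, fun _ => DualNumber.eps, ?_, ?_, ?_⟩
    · intro i; rw [pow_two, DualNumber.eps_mul_eps]
    · intro h
      have := congrArg TrivSqZeroExt.snd h
      simp at this
    · intro i hi; omega
  | succ j ih =>
    obtain ⟨R, _, _, e, he, h0, hr⟩ := ih
    obtain ⟨R', _, _, φ, hφ, s, t, hs, ht, hst⟩ := step4 k R (e j) (he j)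
    refine ⟨R', inferInstance, inferInstance,
      fun i => if i ≤ 10 * j then φ (e i) else
        if i ≤ 10 * j + 5 then s (i - (10 * j + 1)) else t (i - (10 * j + 6)), ?_, ?_, ?_⟩
    · intro i
      dsimp only
      split_ifs
      · rw [← map_pow, he, map_zero]
      · exact hs _
      · exact ht _
    · simpa using (map_ne_zero_iff φ hφ).2 h0
    · intro i hi
      dsimp only
      rw [if_pos (show i ≤ 10 * j by omega)]
      rcases Nat.lt_succ_iff_lt_or_eq.1 hi with h | h
      · have := (hr i h).map (φ : R →+* R')
        simp only [RingHom.coe_coe, map_sum] at this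
        convert this using 1
        · apply Finset.sum_congr rfl
          intro l hl
          have := Finset.mem_range.1 hl
          rw [if_pos (by omega)]
        · apply Finset.sum_congr rfl
          intro l hl
          have := Finset.mem_range.1 hl
          rw [if_pos (by omega)]
      · subst h
        convert hst using 1
        · apply Finset.sum_congr rfl
          intro l hl
          have := Finset.mem_range.1 hl
          rw [if_neg (by omega), if_pos (by omega)]
          congr 1; omega
        · apply Finset.sum_congr rfl
          intro l hl
          have := Finset.mem_range.1 hl
          rw [if_neg (by omega), if_neg (by omega)]
          congr 1; omega

open MvPolynomial in
lemma chainI (k : Type) [Field k] [CharZero k] (j : ℕ) :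
    ∃ I : Ideal (MvPolynomial ℕ k), (∀ i, (X i) ^ 2 ∈ I) ∧ X 0 ∉ I ∧ ∀ i < j,
      Rel (Ideal.Quotient.mk I (X i))
        (Ideal.Quotient.mk I (∑ l ∈ Finset.range 5, X (10 * i + 1 + l)))
        (Ideal.Quotient.mk I (∑ l ∈ Finset.range 5, X (10 * i + 6 + l))) := by
  obtain ⟨R, _, _, e, he, h0, hr⟩ := chain k j
  refine ⟨RingHom.ker (aeval e : MvPolynomial ℕ k →ₐ[k] R), ?_, ?_, ?_⟩
  · intro i; simp [RingHom.mem_ker, he]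
  · simpa [RingHom.mem_ker] using h0
  · intro i hi
    obtain ⟨h1, h2, h3⟩ := hr i hi
    refine ⟨?_, ?_, ?_⟩
    · simp only [← map_pow, ← map_mul, ← map_add]
      rw [Ideal.Quotient.eq, RingHom.mem_ker]
      simp only [map_sub, map_add, map_mul, map_pow, map_sum, aeval_X]
      exact sub_eq_zero.2 h1
    · rw [show (5 : MvPolynomial ℕ k ⧸ RingHom.ker (aeval e : MvPolynomial ℕ k →ₐ[k] R))
        = Ideal.Quotient.mk _ 5 from rfl,
        show (2 : MvPolynomial ℕ k ⧸ RingHom.ker (aeval e : MvPolynomial ℕ k →ₐ[k] R))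
        = Ideal.Quotient.mk _ 2 from rfl]
      simp only [← map_pow, ← map_mul, ← map_add]
      rw [Ideal.Quotient.eq_zero_iff_mem, RingHom.mem_ker]
      simp only [map_sub, map_add, map_mul, map_pow, map_sum, aeval_X, map_ofNat]
      exact h2
    · rw [show (5 : MvPolynomial ℕ k ⧸ RingHom.ker (aeval e : MvPolynomial ℕ k →ₐ[k] R))
        = Ideal.Quotient.mk _ 5 from rfl,
        show (2 : MvPolynomial ℕ k ⧸ RingHom.ker (aeval e : MvPolynomial ℕ k →ₐ[k] R))
        = Ideal.Quotient.mk _ 2 from rfl]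
      simp only [← map_pow, ← map_mul, ← map_add]
      rw [Ideal.Quotient.eq_zero_iff_mem, RingHom.mem_ker]
      simp only [map_sub, map_add, map_mul, map_pow, map_sum, aeval_X, map_ofNat]
      exact h3

lemma rel_iff {R : Type} [CommRing R] (I : Ideal R) (x u v : R) :
    Rel (Ideal.Quotient.mk I x) (Ideal.Quotient.mk I u) (Ideal.Quotient.mk I v) ↔
    (x - (u ^ 5 + u ^ 2 * v ^ 2 + v ^ 5) ∈ I ∧
    5 * u ^ 4 + 2 * (u * v ^ 2) ∈ I ∧ 5 * v ^ 4 + 2 * (u ^ 2 * v) ∈ I) := by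
  rw [← Ideal.Quotient.eq, ← Ideal.Quotient.eq_zero_iff_mem, ← Ideal.Quotient.eq_zero_iff_mem]
  simp only [Rel, map_add, map_mul, map_pow, map_ofNat]

open MvPolynomial in
lemma limI (k : Type) [Field k] [CharZero k] :
    ∃ I : Ideal (MvPolynomial ℕ k), (∀ i, (X i) ^ 2 ∈ I) ∧ X 0 ∉ I ∧ ∀ i,
      Rel (Ideal.Quotient.mk I (X i))
        (Ideal.Quotient.mk I (∑ l ∈ Finset.range 5, X (10 * i + 1 + l)))
        (Ideal.Quotient.mk I (∑ l ∈ Finset.range 5, X (10 * i + 6 + l))) := by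
  choose I h2 h0 hr using chainI k
  let J : Ideal (MvPolynomial ℕ k) :=
    { carrier := {p | ∃ N, ∀ j ≥ N, p ∈ I j}
      add_mem' := by
        rintro a b ⟨N, hN⟩ ⟨M, hM⟩
        exact ⟨max N M, fun j hj => (I j).add_mem (hN j (le_trans (le_max_left _ _) hj))
          (hM j (le_trans (le_max_right _ _) hj))⟩
      zero_mem' := ⟨0, fun j _ => (I j).zero_mem⟩
      smul_mem' := by
        rintro c p ⟨N, hN⟩
        exact ⟨N, fun j hj => (I j).smul_mem c (hN j hj)⟩ }
  refine ⟨J, fun i => ⟨0, fun j _ => h2 j i⟩, ?_, ?_⟩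
  · rintro ⟨N, hN⟩
    exact h0 N (hN N le_rfl)
  · intro i
    rw [rel_iff]
    have := fun j (hj : j ≥ i + 1) => (rel_iff _ _ _ _).1 (hr j i (by omega))
    exact ⟨⟨i + 1, fun j hj => (this j hj).1⟩, ⟨i + 1, fun j hj => (this j hj).2.1⟩,
      ⟨i + 1, fun j hj => (this j hj).2.2⟩⟩

lemma rel_D {k R : Type} [Field k] [CommRing R] [Algebra k R] {x u v : R} (h : Rel x u v) :
    KaehlerDifferential.D k R x = 0 := by
  obtain ⟨h1, h2, h3⟩ := h
  have : KaehlerDifferential.D k R x =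
      (5 * u ^ 4 + 2 * (u * v ^ 2)) • KaehlerDifferential.D k R u +
      (5 * v ^ 4 + 2 * (u ^ 2 * v)) • KaehlerDifferential.D k R v := by
    rw [h1]
    simp only [map_add, Derivation.leibniz, Derivation.leibniz_pow]
    module
  rw [this, h2, h3]; simp

end Gab

open MvPolynomial

/-- Theorem 2.2 (Gabber): over any field `k` of characteristic zero there is a
local `k`-algebra whose maximal ideal is nonzero and consists of nilpotents,
yet which is formally unramified over `k` (i.e. `Ω_{R/k} = 0`).  In
particular there is a non-reduced formally unramified `k`-algebra. -/
theorem stmt7 (k : Type) [Field k] [CharZero k] :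
    ∃ (R : Type) (_ : CommRing R) (_ : IsLocalRing R) (_ : Algebra k R),
      IsLocalRing.maximalIdeal R ≠ ⊥ ∧
      (∀ x ∈ IsLocalRing.maximalIdeal R, IsNilpotent x) ∧
      Subsingleton (KaehlerDifferential k R) := by
  obtain ⟨I, h2, h0, hr⟩ := Gab.limI k
  let R := MvPolynomial ℕ k ⧸ I
  let π : MvPolynomial ℕ k →ₐ[k] R := Ideal.Quotient.mkₐ k I
  have hπ : Function.Surjective π := Ideal.Quotient.mkₐ_surjective k I
  have hsq : ∀ i, π (X i) ^ 2 = 0 := fun i => by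
    rw [← map_pow]; exact (Ideal.Quotient.eq_zero_iff_mem).2 (h2 i)
  have hne : π (X 0) ≠ 0 := fun h => h0 ((Ideal.Quotient.eq_zero_iff_mem).1 h)
  have : Nontrivial R := ⟨⟨_, _, hne⟩⟩
  have dec : ∀ r : R, ∃ (c : k) (m : R), IsNilpotent m ∧ r = algebraMap k R c + m := by
    intro r
    obtain ⟨p, rfl⟩ := hπ r
    induction p using MvPolynomial.induction_on with
    | C a => exact ⟨a, 0, IsNilpotent.zero, by rw [add_zero]; exact π.commutes a⟩
    | add p q hp hq =>
      obtain ⟨c, m, hm, h⟩ := hp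
      obtain ⟨c', m', hm', h'⟩ := hq
      refine ⟨c + c', m + m', (Commute.all m m').isNilpotent_add hm hm', ?_⟩
      rw [map_add, h, h', map_add]; ring
    | mul_X p i _ =>
      refine ⟨0, π (p * X i), ⟨2, ?_⟩, by simp⟩
      rw [map_mul, mul_pow, hsq, mul_zero]
  have unit : ∀ (c : k) (m : R), c ≠ 0 → IsNilpotent m → IsUnit (algebraMap k R c + m) := by
    intro c m hc hm
    exact hm.isUnit_add_left_of_commute ((isUnit_iff_ne_zero.2 hc).map (algebraMap k R))
      (Commute.all _ _)
  have loc : IsLocalRing R := by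
    apply IsLocalRing.of_isUnit_or_isUnit_one_sub_self
    intro r
    obtain ⟨c, m, hm, rfl⟩ := dec r
    by_cases hc : c = 0
    · right
      subst hc
      rw [map_zero, zero_add]
      exact hm.isUnit_one_sub
    · left
      exact unit c m hc hm
  refine ⟨R, inferInstance, loc, inferInstance, ?_, ?_, ?_⟩
  · intro h
    apply hne
    have : π (X 0) ∈ IsLocalRing.maximalIdeal R := by
      rw [IsLocalRing.mem_maximalIdeal, mem_nonunits_iff]
      intro hu
      have h3 := hu.pow 2
      rw [hsq] at h3
      exact not_isUnit_zero h3
    rw [h] at this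
    simpa using this
  · intro r hr
    obtain ⟨c, m, hm, rfl⟩ := dec r
    by_cases hc : c = 0
    · subst hc; simpa using hm
    · exact absurd (unit c m hc hm) hr
  · have hD : ∀ r : R, KaehlerDifferential.D k R r = 0 := by
      intro r
      obtain ⟨p, rfl⟩ := hπ r
      induction p using MvPolynomial.induction_on with
      | C a =>
        rw [show π (C a) = algebraMap k R a from π.commutes a]
        simp
      | add p q hp hq => rw [map_add, map_add, hp, hq, add_zero]
      | mul_X p i hp =>
        have : KaehlerDifferential.D k R (π (X i)) = 0 := Gab.rel_D (hr i)
        rw [map_mul, Derivation.leibniz, hp, this]; simp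
    rw [← not_nontrivial_iff_subsingleton]
    intro hn
    have htop := KaehlerDifferential.span_range_derivation k R
    have : Set.range (KaehlerDifferential.D k R) ⊆ {0} := by
      rintro _ ⟨r, rfl⟩; exact hD r
    have h4 : (⊤ : Submodule R (KaehlerDifferential k R)) ≤ ⊥ := by
      rw [← htop, Submodule.span_le]; exact this
    exact bot_ne_top (le_antisymm bot_le h4)
end

section
/- Let (R, m, k) be a local algebra over a field L such that R is m-adically separated (∩_{n∈ℕ} m^n = 0), the composite L → R → k is a separable field extension, and Ω_{R/L} = 0. Then R is a field. -/
/-- A (possibly transcendental) field extension `L ⊆ K` is separable if every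
finitely generated subextension admits a separating transcendence basis: a
subset `t` of the subextension which is algebraically independent over `L`
and over which the subextension is separably algebraic. -/
def IsSeparableFieldExtension (L K : Type) [Field L] [Field K] [Algebra L K] : Prop :=
  ∀ s : Finset K, ∃ t : Set K,
    t ⊆ (IntermediateField.adjoin L (s : Set K) : Set K) ∧
    AlgebraicIndependent L ((↑) : t → K) ∧
    ∀ x ∈ IntermediateField.adjoin L (s : Set K),
      IsIntegral (IntermediateField.adjoin L t) x ∧
      (minpoly (IntermediateField.adjoin L t) x).Separable

open MvPolynomial in
lemma h1_of_fg (L K : Type) [Field L] [Field K] [Algebra L K]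
    (h : ∀ s : Finset K, Subsingleton (Algebra.H1Cotangent L (IntermediateField.adjoin L (s : Set K)))) :
    Subsingleton (Algebra.H1Cotangent L K) := by
  refine (Algebra.Extension.subsingleton_h1Cotangent
    (Algebra.Generators.self L K).toExtension).mpr ?_
  rw [injective_iff_map_eq_zero]
  intro x hx
  obtain ⟨⟨f, hf⟩, rfl⟩ := Algebra.Extension.Cotangent.mk_surjective x
  rw [Algebra.Extension.cotangentComplex_mk] at hx
  have hd : ∀ i : K, aeval (id : K → K) (pderiv i (f : MvPolynomial K L)) = 0 := by
    intro i
    have := (Algebra.Generators.self L K).cotangentSpaceBasis_repr_one_tmul f i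
    rw [hx] at this
    rw [map_zero] at this
    exact this.symm
  have hf0 : aeval (id : K → K) (f : MvPolynomial K L) = 0 := hf
  classical
  let s : Finset K := (f : MvPolynomial K L).vars
  let K0 := IntermediateField.adjoin L (s : Set K)
  have hs := h s
  obtain ⟨g, hg⟩ := exists_rename_eq_of_vars_subset_range (f : MvPolynomial K L)
    (Subtype.val : K0 → K) Subtype.val_injective (by
      intro y hy
      exact ⟨⟨y, IntermediateField.subset_adjoin L _ hy⟩, rfl⟩)
  have key : ∀ p : MvPolynomial K0 L,
      aeval (id : K → K) (rename (Subtype.val : K0 → K) p)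
        = ((aeval (id : K0 → K0) p : K0) : K) := by
    intro p
    rw [aeval_rename]
    have : (aeval ((id : K → K) ∘ (Subtype.val : K0 → K)) : MvPolynomial K0 L →ₐ[L] K)
        = K0.val.comp (aeval (id : K0 → K0)) := by
      ext i; simp
    rw [this]; rfl
  have hg0 : aeval (id : K0 → K0) g = 0 := by
    apply Subtype.val_injective
    rw [← key, hg, hf0]; rfl
  have hgd : ∀ i : K0, aeval (id : K0 → K0) (pderiv i g) = 0 := by
    intro i
    apply Subtype.val_injective
    rw [← key, ← pderiv_rename Subtype.val_injective, hg, hd]; rfl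
  have hinj := (Algebra.Extension.subsingleton_h1Cotangent
    (Algebra.Generators.self L K0).toExtension).mp hs
  have hgk : g ∈ (Algebra.Generators.self L K0).toExtension.ker := hg0
  have hz : Algebra.Extension.Cotangent.mk (P := (Algebra.Generators.self L K0).toExtension)
      ⟨g, hgk⟩ = 0 := by
    apply hinj
    rw [map_zero, Algebra.Extension.cotangentComplex_mk]
    apply (Algebra.Generators.self L K0).cotangentSpaceBasis.repr.injective
    ext i
    rw [Algebra.Generators.cotangentSpaceBasis_repr_one_tmul]
    rw [map_zero]
    exact congrArg Subtype.val (hgd i)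
  rw [Algebra.Extension.Cotangent.mk_eq_zero_iff] at hz ⊢
  let φ : MvPolynomial K0 L →+* MvPolynomial K L :=
    (rename (Subtype.val : K0 → K) : MvPolynomial K0 L →ₐ[L] MvPolynomial K L).toRingHom
  let I : Ideal (MvPolynomial K0 L) := (Algebra.Generators.self L K0).toExtension.ker
  let J : Ideal (MvPolynomial K L) := (Algebra.Generators.self L K).toExtension.ker
  have hz' : g ∈ I ^ 2 := hz
  have hm := Ideal.mem_map_of_mem φ hz'
  rw [Ideal.map_pow] at hm
  have hle : Ideal.map φ I ≤ J := by
    rw [Ideal.map_le_iff_le_comap]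
    intro p hp
    have hp' : aeval (id : K0 → K0) (p : MvPolynomial K0 L) = 0 := hp
    change aeval (id : K → K) (rename (Subtype.val : K0 → K) p) = 0
    rw [key, hp']; rfl
  have h2 : φ g ∈ J ^ 2 := Ideal.pow_right_mono hle 2 hm
  have h3 : φ g = f := hg
  rw [h3] at h2
  exact h2

lemma smooth_fg (L K : Type) [Field L] [Field K] [Algebra L K]
    (h : IsSeparableFieldExtension L K) (s : Finset K) :
    Algebra.FormallySmooth L (IntermediateField.adjoin L (s : Set K)) := by
  obtain ⟨t, ht, hind, hsep⟩ := h s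
  have hle : IntermediateField.adjoin L t ≤ IntermediateField.adjoin L (s : Set K) :=
    IntermediateField.adjoin_le_iff.mpr ht
  have hF : Algebra.FormallySmooth L (IntermediateField.adjoin L t) := by
    have := Algebra.FormallySmooth.adjoin_of_algebraicIndependent hind
    rwa [Subtype.range_coe] at this
  let : Algebra (IntermediateField.adjoin L t) (IntermediateField.adjoin L (s : Set K)) :=
    (IntermediateField.inclusion hle).toRingHom.toAlgebra
  have : IsScalarTower L (IntermediateField.adjoin L t)
      (IntermediateField.adjoin L (s : Set K)) := IsScalarTower.of_algebraMap_eq fun _ => rfl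
  have : IsScalarTower (IntermediateField.adjoin L t)
      (IntermediateField.adjoin L (s : Set K)) K := IsScalarTower.of_algebraMap_eq fun _ => rfl
  have : Algebra.IsSeparable (IntermediateField.adjoin L t)
      (IntermediateField.adjoin L (s : Set K)) := by
    refine ⟨fun x => ?_⟩
    have h := (hsep x.1 x.2).2
    have e := minpoly.algebraMap_eq (A := IntermediateField.adjoin L t)
      (B := IntermediateField.adjoin L (s : Set K)) (B' := K)
      (algebraMap (IntermediateField.adjoin L (s : Set K)) K).injective x
    unfold IsSeparable
    rw [← e]
    exact h
  have : Algebra.FormallyEtale (IntermediateField.adjoin L t)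
      (IntermediateField.adjoin L (s : Set K)) := Algebra.FormallyEtale.of_isSeparable _ _
  exact .comp _ (IntermediateField.adjoin L t) _

/-- Theorem 3.1: let `(R, m, k)` be a local algebra over a field `L` with
which is `m`-adically separated, residue field separable over `L`, and `Ω_{R/L} = 0`.
Then `R` is a field. -/
theorem stmt10 (L : Type) [Field L]
    (R : Type) [CommRing R] [IsLocalRing R] [Algebra L R]
    (hm : (⨅ n : ℕ, IsLocalRing.maximalIdeal R ^ n) = ⊥)
    (hsep : IsSeparableFieldExtension L (IsLocalRing.ResidueField R))
    (homega : Subsingleton (KaehlerDifferential L R)) :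
    IsField R := by
  have h1 : Subsingleton (Algebra.H1Cotangent L (IsLocalRing.ResidueField R)) :=
    h1_of_fg _ _ fun s => (smooth_fg _ _ hsep s).subsingleton_h1Cotangent
  have h2 : Subsingleton (Algebra.H1Cotangent R (IsLocalRing.ResidueField R)) := by
    refine subsingleton_of_forall_eq 0 fun x => ?_
    obtain ⟨y, rfl⟩ := (Algebra.H1Cotangent.exact_map_δ L R (IsLocalRing.ResidueField R) x).mp
      (Subsingleton.elim _ _)
    rw [Subsingleton.elim y 0, map_zero]
  have h3 := (Algebra.FormallySmooth.kerCotangentToTensor_injective_iff (R := R) (P := R)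
    (A := IsLocalRing.ResidueField R) IsLocalRing.residue_surjective).mpr h2
  have h4 : IsLocalRing.maximalIdeal R ≤ IsLocalRing.maximalIdeal R ^ 2 := by
    intro x hx
    have hx' : x ∈ RingHom.ker (algebraMap R (IsLocalRing.ResidueField R)) :=
      IsLocalRing.residue_eq_zero_iff x |>.mpr hx
    have h5 : Ideal.toCotangent _ (⟨x, hx'⟩ :
      RingHom.ker (algebraMap R (IsLocalRing.ResidueField R))) = 0 := h3 (Subsingleton.elim _ _)
    rw [Ideal.toCotangent_eq_zero] at h5
    have : RingHom.ker (algebraMap R (IsLocalRing.ResidueField R)) = IsLocalRing.maximalIdeal R :=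
      IsLocalRing.ker_residue
    exact this ▸ (show x ∈ RingHom.ker (algebraMap R (IsLocalRing.ResidueField R)) ^ 2 from h5)
  have h6 : ∀ n : ℕ, IsLocalRing.maximalIdeal R ≤ IsLocalRing.maximalIdeal R ^ n := by
    have hi : IsLocalRing.maximalIdeal R * IsLocalRing.maximalIdeal R
        = IsLocalRing.maximalIdeal R := le_antisymm Ideal.mul_le_left (by rwa [← sq])
    intro n
    induction n with
    | zero => simp
    | succ n ih => rw [pow_succ]; exact hi.ge.trans (Ideal.mul_mono_left ih)
  rw [IsLocalRing.isField_iff_maximalIdeal_eq, eq_bot_iff, ← hm]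
  exact le_iInf h6
end

section
/- Let k be a perfect field and A a Noetherian k-algebra with Ω_{A/k} = 0. Then A is isomorphic to a finite product of perfect fields. -/
open IntermediateField Polynomial in
theorem aux_finrank (M K : Type) [Field M] [Field K] [Algebra M K] (p : ℕ) (hp : p.Prime)
    [CharP K p]
    (h : ∀ x : K, x ^ p ∈ (algebraMap M K).range) (x : K) (hx : x ∉ (algebraMap M K).range) :
    Module.finrank M M⟮x⟯ = p ∧ FiniteDimensional M M⟮x⟯ := by
  have : Fact p.Prime := ⟨hp⟩
  have : ExpChar K p := ExpChar.prime hp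
  obtain ⟨c, hc⟩ := h x
  have hirr : Irreducible (X ^ p - C c : M[X]) := by
    apply X_pow_sub_C_irreducible_of_prime hp
    intro b hb
    apply hx
    refine ⟨b, ?_⟩
    apply frobenius_inj K p
    simp only [frobenius_def]
    rw [← map_pow, hb, hc]
  have hm : (X ^ p - C c : M[X]).Monic := monic_X_pow_sub_C c hp.ne_zero
  have hmin : X ^ p - C c = minpoly M x :=
    minpoly.eq_of_irreducible_of_monic hirr (by simp [hc]) hm
  have hint : IsIntegral M x := ⟨_, hm, by simp [hc]⟩
  refine ⟨?_, adjoin.finiteDimensional hint⟩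
  rw [adjoin.finrank hint, ← hmin, natDegree_X_pow_sub_C]

open IntermediateField in
theorem aux_perfect (k : Type) [Field k] [PerfectField k] (K : Type) [Field K] [Algebra k K]
    [Algebra.FormallyUnramified k K] : PerfectField K := by
  obtain ⟨p, hpK⟩ := CharP.exists K
  rcases CharP.char_is_prime_or_zero K p with hp | rfl
  swap
  · have := CharP.charP_to_charZero K
    infer_instance
  have : Fact p.Prime := ⟨hp⟩
  have : ExpChar K p := ExpChar.prime hp
  have : CharP k p := (Algebra.charP_iff k K p).mpr hpK
  have : ExpChar k p := ExpChar.prime hp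
  have : PerfectRing k p := PerfectField.toPerfectRing p
  suffices hs : Function.Surjective (frobenius K p) by
    have := PerfectRing.ofSurjective K p hs
    exact PerfectRing.toPerfectField K p
  by_contra hns
  simp only [Function.Surjective, not_forall] at hns
  obtain ⟨a, ha⟩ := hns
  let F : IntermediateField k K := (frobenius K p).fieldRange.toIntermediateField (by
    intro x
    obtain ⟨y, rfl⟩ := surjective_frobenius k p x
    exact ⟨algebraMap k K y, by simp [frobenius_def]⟩)
  have hF : ∀ x : K, x ^ p ∈ F := fun x => ⟨x, rfl⟩
  have haF : a ∉ F := fun ⟨y, hy⟩ => ha ⟨y, hy⟩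
  obtain ⟨M, hFM, hM⟩ := zorn_le_nonempty₀ {M : IntermediateField k K | a ∉ M} (by
    intro c hc hch y hy
    have : Nonempty c := ⟨⟨y, hy⟩⟩
    refine ⟨⨆ i : c, (i : IntermediateField k K), ?_, fun z hz => le_iSup (fun i : c => (i : IntermediateField k K)) ⟨z, hz⟩⟩
    intro hmem
    rw [← SetLike.mem_coe, coe_iSup_of_directed hch.directedOn.directed_val, Set.mem_iUnion] at hmem
    obtain ⟨i, hi⟩ := hmem
    exact hc i.2 hi) F haF
  have haM : a ∉ M := hM.1
  have hpow : ∀ x : K, x ^ p ∈ (algebraMap M K).range := fun x => ⟨⟨x ^ p, hFM (hF x)⟩, rfl⟩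
  have hmemr : ∀ x : K, x ∈ (algebraMap M K).range → x ∈ M := by
    rintro _ ⟨y, rfl⟩; exact y.2
  have hamr := fun h => haM (hmemr a h)
  obtain ⟨ha1, ha2⟩ := aux_finrank M K p hp hpow a hamr
  have htop : M⟮a⟯ = ⊤ := by
    rw [eq_top_iff]
    intro x _
    by_contra hx
    have hxM : x ∉ (algebraMap M K).range := by
      rintro ⟨y, rfl⟩
      exact hx (M⟮a⟯.algebraMap_mem y)
    obtain ⟨hx1, hx2⟩ := aux_finrank M K p hp hpow x hxM
    have hax : a ∈ M⟮x⟯ := by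
      by_contra hax
      have hle : M ≤ (M⟮x⟯).restrictScalars k := fun y hy => (M⟮x⟯).algebraMap_mem ⟨y, hy⟩
      have := hM.2 (y := (M⟮x⟯).restrictScalars k) hax hle
      exact hxM ⟨⟨x, this (mem_adjoin_simple_self M x)⟩, rfl⟩
    have hle : M⟮a⟯ ≤ M⟮x⟯ := adjoin_simple_le_iff.mpr hax
    have := eq_of_le_of_finrank_eq hle (ha1.trans hx1.symm)
    rw [this] at hx
    exact hx (mem_adjoin_simple_self M x)
  have : FiniteDimensional M K := by
    rw [htop] at ha2
    exact Module.Finite.equiv (topEquiv (F := M) (E := K)).toLinearEquiv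
  have : Algebra.FormallyUnramified M K := Algebra.FormallyUnramified.of_restrictScalars k M K
  have : CharP M p := (Algebra.charP_iff M K p).mpr hpK
  have : ExpChar M p := ExpChar.prime hp
  have : IsPurelyInseparable M K := (isPurelyInseparable_iff_pow_mem M p).2
    fun x => ⟨1, by simpa using hpow x⟩
  have := Algebra.FormallyUnramified.range_eq_top_of_isPurelyInseparable M K
  exact hamr (this ▸ trivial)

/-- The projection `A/m² → A/m` has a `k`-algebra section. -/
theorem aux_section (k : Type) [Field k] [PerfectField k] (A : Type) [CommRing A] [Algebra k A]
    [Algebra.FormallyUnramified k A] (m : Ideal A) [hm : m.IsMaximal] :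
    ∃ s : A ⧸ m →ₐ[k] A ⧸ m ^ 2, ∀ x,
      Ideal.Quotient.factor (Ideal.pow_le_self two_ne_zero) (s x) = x := by
  let : Field (A ⧸ m) := Ideal.Quotient.field m
  have : PerfectField (A ⧸ m) := aux_perfect k (A ⧸ m)
  have hker : ∀ x : A ⧸ m ^ 2,
      Ideal.Quotient.factor (Ideal.pow_le_self two_ne_zero : m ^ 2 ≤ m) x = 0 → x ^ 2 = 0 := by
    intro x hx
    obtain ⟨x, rfl⟩ := Ideal.Quotient.mk_surjective x
    rw [Ideal.Quotient.factor_mk, Ideal.Quotient.eq_zero_iff_mem] at hx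
    rw [← map_pow, Ideal.Quotient.eq_zero_iff_mem]
    exact Ideal.pow_mem_pow hx 2
  obtain ⟨p, hpk⟩ := CharP.exists k
  rcases CharP.char_is_prime_or_zero k p with hp | rfl
  · have : Fact p.Prime := ⟨hp⟩
    have : CharP (A ⧸ m) p := (Algebra.charP_iff k (A ⧸ m) p).mp hpk
    have : Nontrivial (A ⧸ m ^ 2) := Ideal.Quotient.nontrivial_iff.mpr (by
      intro h
      exact hm.ne_top (top_le_iff.mp (h ▸ Ideal.pow_le_self two_ne_zero)))
    have : CharP (A ⧸ m ^ 2) p := (Algebra.charP_iff k (A ⧸ m ^ 2) p).mp hpk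
    have : ExpChar k p := ExpChar.prime hp
    have : ExpChar (A ⧸ m) p := ExpChar.prime hp
    have : ExpChar (A ⧸ m ^ 2) p := ExpChar.prime hp
    have : PerfectRing k p := PerfectField.toPerfectRing p
    have : PerfectRing (A ⧸ m) p := PerfectField.toPerfectRing p
    let ψ : A ⧸ m →+* A ⧸ m ^ 2 := Ideal.Quotient.lift m
      ((frobenius (A ⧸ m ^ 2) p).comp (Ideal.Quotient.mk (m ^ 2))) (by
        intro a ha
        have : (Ideal.Quotient.mk (m ^ 2) a) ^ 2 = 0 := hker _ (by
          rw [Ideal.Quotient.factor_mk, Ideal.Quotient.eq_zero_iff_mem]; exact ha)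
        simp only [RingHom.comp_apply, frobenius_def]
        exact pow_eq_zero_of_le hp.two_le this)
    have hψ : ∀ a : A, ψ (Ideal.Quotient.mk m a) = (Ideal.Quotient.mk (m ^ 2) a) ^ p :=
      fun a => rfl
    let s : A ⧸ m →+* A ⧸ m ^ 2 := ψ.comp (frobeniusEquiv (A ⧸ m) p).symm.toRingHom
    have hs : ∀ a : A, s ((Ideal.Quotient.mk m a) ^ p) = (Ideal.Quotient.mk (m ^ 2) a) ^ p := by
      intro a
      rw [← hψ]
      change ψ ((frobeniusEquiv (A ⧸ m) p).symm _) = _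
      rw [frobeniusEquiv_symm_pow]
    refine ⟨{ s with commutes' := ?_ }, ?_⟩
    · intro c
      obtain ⟨d, rfl⟩ := surjective_frobenius k p c
      have := hs (algebraMap k A d)
      change s _ = _
      rw [frobenius_def, map_pow (algebraMap k (A ⧸ m)), map_pow (algebraMap k (A ⧸ m ^ 2))]
      exact this
    · intro x
      obtain ⟨y, rfl⟩ := surjective_frobenius (A ⧸ m) p x
      obtain ⟨a, rfl⟩ := Ideal.Quotient.mk_surjective y
      change Ideal.Quotient.factor _ (s _) = _
      rw [frobenius_def, hs, map_pow, Ideal.Quotient.factor_mk]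
  · have : CharZero k := CharP.charP_to_charZero k
    have : Algebra.FormallySmooth k (A ⧸ m) := by
      obtain ⟨ι, v, hv⟩ := exists_isTranscendenceBasis' k (A ⧸ m)
      have := hv.isAlgebraic_field
      exact .of_algebraicIndependent_of_isSeparable hv.1
    let g : A ⧸ m ^ 2 →ₐ[k] A ⧸ m :=
      Ideal.Quotient.factorₐ k (Ideal.pow_le_self two_ne_zero)
    have hg : Function.Surjective g := Ideal.Quotient.factor_surjective (Ideal.pow_le_self two_ne_zero)
    have hn : IsNilpotent (RingHom.ker (g : A ⧸ m ^ 2 →+* A ⧸ m)) := by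
      refine ⟨2, ?_⟩
      have : RingHom.ker (g : A ⧸ m ^ 2 →+* A ⧸ m) = m.map (Ideal.Quotient.mk (m ^ 2)) :=
        Ideal.Quotient.factor_ker (Ideal.pow_le_self two_ne_zero)
      rw [this, ← Ideal.map_pow, Ideal.map_quotient_self]
      rfl
    refine ⟨Algebra.FormallySmooth.liftOfSurjective (AlgHom.id k _) g hg hn, ?_⟩
    intro x
    exact Algebra.FormallySmooth.liftOfSurjective_apply (AlgHom.id k _) g hg hn x

theorem aux_idem (k : Type) [Field k] [PerfectField k] (A : Type) [CommRing A] [Algebra k A]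
    [Algebra.FormallyUnramified k A] (m : Ideal A) [hm : m.IsMaximal] :
    IsIdempotentElem m := by
  obtain ⟨s, hs⟩ := aux_section k A m
  have hle : m ^ 2 ≤ m := Ideal.pow_le_self two_ne_zero
  have hn : IsNilpotent (RingHom.ker (Ideal.Quotient.factor hle)) := by
    refine ⟨2, ?_⟩
    rw [Ideal.Quotient.factor_ker, ← Ideal.map_pow, Ideal.map_quotient_self]
    rfl
  have heq := Algebra.FormallyUnramified.ext' (R := k) (Ideal.Quotient.factor hle) hn
    (Ideal.Quotient.mkₐ k (m ^ 2)) (s.comp (Ideal.Quotient.mkₐ k m)) (by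
      intro x
      simp only [AlgHom.comp_apply]
      rw [hs]
      rfl)
  unfold IsIdempotentElem
  rw [← pow_two]
  refine le_antisymm hle fun x hx => ?_
  have := DFunLike.congr_fun heq x
  rw [← Ideal.Quotient.eq_zero_iff_mem]
  refine this.trans ?_
  have h0 : Ideal.Quotient.mkₐ k m x = 0 := Ideal.Quotient.eq_zero_iff_mem.mpr hx
  rw [AlgHom.comp_apply, h0, map_zero]

/-- Corollary 3.3(ii): a Noetherian `k`-algebra over a perfect field `k` with
`Ω_{A/k} = 0` is a finite product of perfect fields. -/
theorem stmt12 (k : Type) [Field k] [PerfectField k]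
    (A : Type) [CommRing A] [Algebra k A] [IsNoetherianRing A]
    (homega : Subsingleton (KaehlerDifferential k A)) :
    ∃ (n : ℕ) (K : Fin n → Type) (_ : ∀ i, Field (K i)),
      (∀ i, PerfectField (K i)) ∧ Nonempty (A ≃+* ((i : Fin n) → K i)) := by
  have : Algebra.FormallyUnramified k A := ⟨homega⟩
  have key : ∀ m : Ideal A, m.IsMaximal → ∃ e ∈ m, ∀ x ∈ m, (1 - e) * x = 0 := by
    intro m hm
    obtain ⟨e, he, h⟩ := (Ideal.isIdempotentElem_iff_of_fg m
      (IsNoetherian.noetherian m)).mp (aux_idem k A m)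
    refine ⟨e, h ▸ Submodule.mem_span_singleton_self e, fun x hx => ?_⟩
    rw [h] at hx
    obtain ⟨y, rfl⟩ := Submodule.mem_span_singleton.mp hx
    have : e * e = e := he
    rw [smul_eq_mul]
    linear_combination (-y) * this
  have hone : ∀ m : Ideal A, m.IsMaximal → ∀ e ∈ m, 1 - e ∉ m := by
    intro m hm e he h
    exact hm.ne_top ((Ideal.eq_top_iff_one _).mpr (by simpa using m.add_mem h he))
  have : Ring.KrullDimLE 0 A := Ring.KrullDimLE.mk₀ (by
    intro P hP
    obtain ⟨m, hm, hPm⟩ := P.exists_le_maximal hP.ne_top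
    obtain ⟨e, he, h⟩ := key m hm
    have : m ≤ P := fun x hx =>
      (hP.mem_or_mem (by rw [h x hx]; exact P.zero_mem : (1 - e) * x ∈ P)).resolve_left
        fun h1 => hone m hm e he (hPm h1)
    rwa [le_antisymm hPm this])
  have : IsArtinianRing A := isArtinianRing_iff_krullDimLE_zero.mpr inferInstance
  have : IsReduced A := ⟨by
    intro x hx
    by_contra hx0
    obtain ⟨m, hm, hle⟩ := (Ideal.exists_le_maximal (LinearMap.ker (LinearMap.toSpanSingleton A A x)))
      (fun h => hx0 (by
        have : (1 : A) ∈ LinearMap.ker (LinearMap.toSpanSingleton A A x) := h ▸ trivial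
        simpa using this))
    obtain ⟨e, he, h⟩ := key m hm
    obtain ⟨n, hn⟩ := hx
    have hxm : x ∈ m := hm.isPrime.mem_of_pow_mem n (hn ▸ m.zero_mem)
    exact hone m hm e he (hle (by simpa using h x hxm))⟩
  obtain ⟨n, ⟨σ⟩⟩ := Finite.exists_equiv_fin (MaximalSpectrum A)
  refine ⟨n, fun i => A ⧸ (σ.symm i).asIdeal, fun i => Ideal.Quotient.field _, fun i => ?_, ⟨?_⟩⟩
  · let : Field (A ⧸ (σ.symm i).asIdeal) := Ideal.Quotient.field _
    exact aux_perfect k (A ⧸ (σ.symm i).asIdeal)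
  · exact (IsArtinianRing.equivPi A).toRingEquiv.trans
      (RingEquiv.piCongrLeft (fun I : MaximalSpectrum A => A ⧸ I.asIdeal) σ.symm).symm
end
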